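/- Let α, β ∈ (0,1) and μ be real numbers, and let λ > 2 be real. Then the integral ∫₀¹ (λ−t)^{μ−1}·t^{1−α−β}·₂F₁(1−α, 1−β; 2−α−β; t) dt converges and H_μ(λ) = B(1−α, 1−β)·∫₀¹ (λ−t)^{μ−1}·t^{1−α−β}·₂F₁(1−α, 1−β; 2−α−β; t) dt, where the powers (λ−t)^{μ−1} and t^{1−α−β} are real powers. -/

import Mathlib

open Set MeasureTheory

/-- Pochhammer symbol `(a)_n` for real `a`. -/
noncomputable def poch (a : ℝ) (n : ℕ) : ℝ := (ascPochhammer ℝ n).eval a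

/-- Gauss hypergeometric function `₂F₁(a,b;c;x)` as a series (real version). -/
noncomputable def hyp2F1 (a b c x : ℝ) : ℝ :=
  ∑' n : ℕ, poch a n * poch b n / (poch c n * (n.factorial : ℝ)) * x ^ n

/-- Generalized hypergeometric function `₃F₂(a₁,a₂,a₃;b₁,b₂;x)` (real version). -/
noncomputable def hyp3F2 (a₁ a₂ a₃ b₁ b₂ x : ℝ) : ℝ :=
  ∑' n : ℕ, poch a₁ n * poch a₂ n * poch a₃ n /
    (poch b₁ n * poch b₂ n * (n.factorial : ℝ)) * x ^ n

/-- Beta function `B(a,b) = Γ(a)Γ(b)/Γ(a+b)` (real version). -/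
noncomputable def betaR (a b : ℝ) : ℝ :=
  Real.Gamma a * Real.Gamma b / Real.Gamma (a + b)

/-- `H_μ(λ) = (1/((1−α)(1−β)))·(λ−1)^{μ−1}·₃F₂(1,1,1−μ;2−α,2−β;1/(1−λ))`. -/
noncomputable def Hfun (α β μ : ℝ) : ℝ → ℝ :=
  fun x => (1 / ((1 - α) * (1 - β))) * (x - 1) ^ (μ - 1) *
    hyp3F2 1 1 (1 - μ) (2 - α) (2 - β) (1 / (1 - x))

theorem poch_pos {a : ℝ} (ha : 0 < a) (n : ℕ) : 0 < poch a n :=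
  ascPochhammer_pos n a ha

theorem poch_succ (a : ℝ) (n : ℕ) : poch a (n + 1) = poch a n * (a + n) :=
  ascPochhammer_succ_eval n a

theorem poch_succ_left (a : ℝ) (n : ℕ) : poch a (n + 1) = a * poch (a + 1) n := by
  simp [poch, ascPochhammer_succ_left, Polynomial.eval_comp]

theorem poch_one (n : ℕ) : poch 1 n = n.factorial :=
  ascPochhammer_eval_one ℝ n

theorem poch_le_poch {a b : ℝ} (ha : 0 < a) (hab : a ≤ b) (n : ℕ) : poch a n ≤ poch b n := by
  induction n with
  | zero => simp [poch]
  | succ n ih =>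
    rw [poch_succ, poch_succ]
    have := poch_pos (ha.trans_le hab) n
    gcongr

theorem Gamma_add_nat_eq_poch_mul {a : ℝ} (ha : 0 < a) (n : ℕ) :
    Real.Gamma (a + n) = poch a n * Real.Gamma a := by
  induction n with
  | zero => simp [poch]
  | succ n ih =>
    have h : a + (n : ℝ) ≠ 0 := by positivity
    rw [poch_succ, Nat.cast_succ, ← add_assoc, Real.Gamma_add_one h, ih]
    ring

theorem hasSum_poch_mul_pow (a : ℝ) {x : ℝ} (hx : |x| < 1) :
    HasSum (fun n : ℕ => poch a n / n.factorial * x ^ n) ((1 - x) ^ (-a)) := by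
  have h := (Real.one_div_one_sub_rpow_hasFPowerSeriesOnBall_zero a).hasSum
    (y := x) (by simpa [← ofReal_norm] using hx)
  have hx1 : 0 ≤ 1 - x := by linarith [(abs_lt.1 hx).2]
  rw [zero_add, one_div, ← Real.rpow_neg hx1] at h
  convert! h using 2 with n
  have hc : Ring.choose (a + n - 1) n = poch a n / n.factorial := by
    rw [eq_div_iff (by positivity), mul_comm, ← nsmul_eq_mul, Ring.choose,
      Ring.factorial_nsmul_multichoose_eq_ascPochhammer, Polynomial.ascPochhammer_smeval_eq_eval, poch]
    congr 1; ring
  simp [hc, mul_comm]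

/-- Termwise integration of a series of nonnegative functions with integrable sum. -/
theorem hasSum_integral_of_nonneg {X : Type*} [MeasurableSpace X] {ν : Measure X}
    {F : ℕ → X → ℝ} {f : X → ℝ} (hF : ∀ k, Integrable (F k) ν) (h0 : ∀ k, 0 ≤ᵐ[ν] F k)
    (hs : ∀ᵐ x ∂ν, HasSum (fun k => F k x) (f x)) (hf : Integrable f ν) :
    HasSum (fun k => ∫ x, F k x ∂ν) (∫ x, f x ∂ν) := by
  refine hasSum_integral_of_dominated_convergence F (fun k => (hF k).1) (fun k => ?_)
    (hs.mono fun x hx => hx.summable) (hf.congr (hs.mono fun x hx => hx.tsum_eq.symm)) hs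
  filter_upwards [h0 k] with x hx
  exact (Real.norm_of_nonneg hx).le

/-- A series of nonnegative functions with summable integrals has an integrable sum. -/
theorem integrable_of_summable_integral_of_nonneg {X : Type*} [MeasurableSpace X] {ν : Measure X}
    {F : ℕ → X → ℝ} {f : X → ℝ} (hF : ∀ k, Integrable (F k) ν) (h0 : ∀ k, 0 ≤ᵐ[ν] F k)
    (hs : ∀ᵐ x ∂ν, HasSum (fun k => F k x) (f x)) (hsum : Summable fun k => ∫ x, F k x ∂ν) :
    Integrable f ν := by
  have h0' : ∀ᵐ x ∂ν, ∀ k, 0 ≤ F k x := ae_all_iff.2 h0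
  refine ⟨aestronglyMeasurable_of_tendsto_ae Filter.atTop
    (f := fun n x => ∑ k ∈ Finset.range n, F k x)
    (fun n => (integrable_finsetSum _ fun k _ => hF k).1)
    (hs.mono fun x hx => hx.tendsto_sum_nat), ?_⟩
  have hfn : 0 ≤ᵐ[ν] f := by
    filter_upwards [hs, h0'] with x hx hx0 using hx.nonneg hx0
  rw [hasFiniteIntegral_iff_ofReal hfn]
  have h : ∫⁻ x, ENNReal.ofReal (f x) ∂ν = ∑' k, ENNReal.ofReal (∫ x, F k x ∂ν) := by
    simp_rw [fun k => ofReal_integral_eq_lintegral_ofReal (hF k) (h0 k)]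
    rw [← lintegral_tsum fun k => (hF k).1.aemeasurable.ennreal_ofReal]
    refine lintegral_congr_ae ?_
    filter_upwards [hs, h0'] with x hx hx0
    rw [← hx.tsum_eq, ENNReal.ofReal_tsum_of_nonneg hx0 hx.summable]
  rw [h, ← ENNReal.ofReal_tsum_of_nonneg (fun k => integral_nonneg_of_ae (h0 k)) hsum]
  exact ENNReal.ofReal_lt_top

theorem integrableOn_beta {u v : ℝ} (hu : 0 < u) (hv : 0 < v) :
    IntegrableOn (fun t : ℝ => t ^ (u - 1) * (1 - t) ^ (v - 1)) (Ioo 0 1) := by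
  have h := (Complex.betaIntegral_convergent (u := u) (v := v) (by simpa) (by simpa))
  rw [intervalIntegrable_iff_integrableOn_Ioo_of_le zero_le_one] at h
  refine IntegrableOn.congr_fun h.re (fun t ht => ?_) measurableSet_Ioo
  have h1 : (0 : ℝ) ≤ 1 - t := by linarith [ht.2]
  simp only [RCLike.re_to_complex]
  rw [← Complex.ofReal_one, ← Complex.ofReal_sub, ← Complex.ofReal_sub, ← Complex.ofReal_sub,
    ← Complex.ofReal_cpow ht.1.le, ← Complex.ofReal_cpow h1, ← Complex.ofReal_mul,
    Complex.ofReal_re]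

theorem integral_beta {u v : ℝ} (hu : 0 < u) (hv : 0 < v) :
    ∫ t in Ioo (0 : ℝ) 1, t ^ (u - 1) * (1 - t) ^ (v - 1) = betaR u v := by
  have h := Complex.betaIntegral_eq_Gamma_mul_div u v (by simpa) (by simpa)
  rw [Complex.betaIntegral, intervalIntegral.integral_of_le zero_le_one,
    integral_Ioc_eq_integral_Ioo] at h
  rw [← Complex.ofReal_inj, ← integral_complex_ofReal, betaR]
  push_cast
  rw [← Complex.Gamma_ofReal, ← Complex.Gamma_ofReal, ← Complex.Gamma_ofReal, Complex.ofReal_add,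
    ← h]
  refine setIntegral_congr_fun measurableSet_Ioo fun t ht => ?_
  have h1 : (0 : ℝ) ≤ 1 - t := by linarith [ht.2]
  simp only [Complex.ofReal_cpow ht.1.le, Complex.ofReal_cpow h1, Complex.ofReal_sub,
    Complex.ofReal_one]

/-- Gauss's summation of `₂F₁(a, b; a + b + n + 1; 1)`, written with beta functions. -/
theorem hasSum_poch_mul_betaR {a b : ℝ} (ha : 0 < a) (hb : 0 < b) (n : ℕ) :
    HasSum (fun k : ℕ => poch a k / k.factorial * betaR (b + k) (a + n + 1))
      (betaR b (n + 1)) := by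
  have hn : (0 : ℝ) < n + 1 := by positivity
  have han : (0 : ℝ) < a + n + 1 := by positivity
  have hbk (k : ℕ) : 0 < b + k := by positivity
  have h := hasSum_integral_of_nonneg (ν := volume.restrict (Ioo (0 : ℝ) 1))
    (F := fun k t => poch a k / k.factorial * (t ^ (b + k - 1) * (1 - t) ^ (a + n + 1 - 1)))
    (f := fun t => t ^ (b - 1) * (1 - t) ^ ((n : ℝ) + 1 - 1))
    (fun k => (integrableOn_beta (hbk k) han).const_mul _) (fun k => ?_) ?_
    (integrableOn_beta hb hn)
  · simpa only [integral_const_mul, integral_beta (hbk _) han, integral_beta hb hn] using h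
  · filter_upwards [ae_restrict_mem measurableSet_Ioo] with t ht
    have h1 : (0 : ℝ) ≤ 1 - t := by linarith [ht.2]
    have := (poch_pos ha k).le
    have := ht.1.le
    simp only [Pi.zero_apply]
    positivity
  · filter_upwards [ae_restrict_mem measurableSet_Ioo] with t ht
    have h1 : (0 : ℝ) < 1 - t := by linarith [ht.2]
    convert! (hasSum_poch_mul_pow a (x := t) (by rw [abs_of_pos ht.1]; exact ht.2)).mul_right
      (t ^ (b - 1) * (1 - t) ^ (a + n + 1 - 1)) using 1
    · ext k
      rw [show b + k - 1 = b - 1 + k by ring, Real.rpow_add ht.1, Real.rpow_natCast]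
      ring
    · rw [mul_left_comm, ← Real.rpow_add h1]
      ring_nf

theorem hasSum_hyp2F1 {a b c x : ℝ} (ha : 0 < a) (hb : 0 < b) (hbc : b ≤ c) (hx0 : 0 ≤ x)
    (hx : x < 1) :
    HasSum (fun n : ℕ => poch a n * poch b n / (poch c n * (n.factorial : ℝ)) * x ^ n)
      (hyp2F1 a b c x) := by
  have hc := hb.trans_le hbc
  refine (Summable.of_nonneg_of_le (fun n => ?_) (fun n => ?_)
    (hasSum_poch_mul_pow a (x := x) (by rwa [abs_of_nonneg hx0])).summable).hasSum
  · have := poch_pos ha n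
    have := poch_pos hb n
    have := poch_pos hc n
    positivity
  · have := poch_pos ha n
    have h1 : poch b n / poch c n ≤ 1 := (div_le_one (poch_pos hc n)).2 (poch_le_poch hb hbc n)
    rw [mul_comm (poch c n), mul_div_mul_comm]
    gcongr
    exact mul_le_of_le_one_right (by positivity) h1

/-- Integrability and value of the moments of the Euler-type weight `t^{a+b-1} ₂F₁(a,b;a+b;t)`. -/
theorem moment_hyp2F1 {a b : ℝ} (ha : 0 < a) (hb : 0 < b) (n : ℕ) :
    IntegrableOn (fun t : ℝ => (1 - t) ^ n * (t ^ (a + b - 1) * hyp2F1 a b (a + b) t)) (Ioo 0 1) ∧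
    betaR a b * ∫ t in Ioo (0 : ℝ) 1, (1 - t) ^ n * (t ^ (a + b - 1) * hyp2F1 a b (a + b) t) =
      (n.factorial : ℝ) ^ 2 / (poch a (n + 1) * poch b (n + 1)) := by
  have hn : (0 : ℝ) < n + 1 := by positivity
  have hc : 0 < a + b := by positivity
  have hck (k : ℕ) : 0 < a + b + k := by positivity
  set coef : ℕ → ℝ := fun k => poch a k * poch b k / (poch (a + b) k * (k.factorial : ℝ)) with hcoef
  have hcoef0 (k : ℕ) : 0 ≤ coef k := by
    have := poch_pos ha k
    have := poch_pos hb k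
    have := poch_pos hc k
    positivity
  have hG (x : ℝ) (hx : 0 < x) : Real.Gamma x ≠ 0 := (Real.Gamma_pos_of_pos hx).ne'
  have hGn : Real.Gamma ((n : ℝ) + 1) = n.factorial := Real.Gamma_nat_eq_factorial n
  have hGan : Real.Gamma (a + n + 1) = poch a (n + 1) * Real.Gamma a := by
    rw [← Gamma_add_nat_eq_poch_mul ha]; push_cast; ring_nf
  have hGbn : Real.Gamma (b + (n + 1)) = poch b (n + 1) * Real.Gamma b := by
    rw [← Gamma_add_nat_eq_poch_mul hb]; push_cast; ring_nf
  have hval : HasSum (fun k => betaR a b * (coef k * betaR (a + b + k) (n + 1)))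
      ((n.factorial : ℝ) ^ 2 / (poch a (n + 1) * poch b (n + 1))) := by
    convert! (hasSum_poch_mul_betaR ha hb n).mul_left (n.factorial / poch a (n + 1)) using 1
    · ext k
      have := (poch_pos hc k).ne'
      have := (poch_pos ha (n + 1)).ne'
      have := hG _ ha
      have := hG _ hb
      have := hG _ hc
      have h1 := hG (a + b + k + (n + 1)) (by positivity)
      have h2 : b + k + (a + n + 1) = a + b + k + (n + 1) := by ring
      simp only [betaR, hcoef, h2, hGn, hGan, Gamma_add_nat_eq_poch_mul hb,
        Gamma_add_nat_eq_poch_mul hc]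
      field_simp
    · have := (poch_pos ha (n + 1)).ne'
      have := (poch_pos hb (n + 1)).ne'
      have := hG _ hb
      rw [betaR, hGn, hGbn]
      field_simp
  have hbeta : betaR a b ≠ 0 := div_ne_zero (mul_ne_zero (hG _ ha) (hG _ hb)) (hG _ hc)
  set F : ℕ → ℝ → ℝ :=
    fun k t => coef k * (t ^ (a + b + k - 1) * (1 - t) ^ ((n : ℝ) + 1 - 1)) with hFdef
  have hF (k : ℕ) : IntegrableOn (F k) (Ioo 0 1) :=
    (integrableOn_beta (hck k) hn).const_mul _
  have hFint (k : ℕ) : ∫ t in Ioo (0 : ℝ) 1, F k t = coef k * betaR (a + b + k) (n + 1) := by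
    simp only [hFdef, integral_const_mul, integral_beta (hck k) hn]
  have hF0 (k : ℕ) : 0 ≤ᵐ[volume.restrict (Ioo (0 : ℝ) 1)] F k := by
    filter_upwards [ae_restrict_mem measurableSet_Ioo] with t ht
    have h1 : (0 : ℝ) ≤ 1 - t := by linarith [ht.2]
    have := ht.1.le
    have := hcoef0 k
    simp only [Pi.zero_apply, hFdef]
    positivity
  have hs : ∀ᵐ t ∂volume.restrict (Ioo (0 : ℝ) 1), HasSum (fun k => F k t)
      ((1 - t) ^ n * (t ^ (a + b - 1) * hyp2F1 a b (a + b) t)) := by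
    filter_upwards [ae_restrict_mem measurableSet_Ioo] with t ht
    convert! ((hasSum_hyp2F1 ha hb (by linarith : b ≤ a + b) ht.1.le ht.2).mul_left
      (t ^ (a + b - 1))).mul_left ((1 - t) ^ n) using 1
    ext k
    simp only [hFdef]
    rw [add_sub_cancel_right, Real.rpow_natCast,
      show a + b + k - 1 = a + b - 1 + k by ring, Real.rpow_add ht.1, Real.rpow_natCast]
    ring
  have hsum : Summable fun k => ∫ t in Ioo (0 : ℝ) 1, F k t := by
    simp only [hFint]
    exact (summable_mul_left_iff hbeta).1 hval.summable
  have hI := integrable_of_summable_integral_of_nonneg hF hF0 hs hsum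
  refine ⟨hI, ?_⟩
  have h := (hasSum_integral_of_nonneg hF hF0 hs hI).mul_left (betaR a b)
  simp only [hFint] at h
  exact h.unique hval

/-- Binomial expansion of `(l - t)^{m}` in powers of `(1 - t) / (l - 1)`. -/
theorem hasSum_sub_rpow (m : ℝ) {l t : ℝ} (hl : 2 < l) (ht : t ∈ Ioo (0 : ℝ) 1) :
    HasSum (fun n : ℕ => (l - 1) ^ (-m) * (poch m n / n.factorial * (1 / (1 - l)) ^ n) *
      (1 - t) ^ n) ((l - t) ^ (-m)) := by
  have hl1 : 0 < l - 1 := by linarith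
  have hl1' : 1 - l ≠ 0 := by linarith
  have hlt : 0 < l - t := by linarith [ht.2]
  have hx : |(1 - t) / (1 - l)| < 1 := by
    rw [abs_div, abs_of_pos (by linarith [ht.2]), abs_of_neg (by linarith),
      div_lt_one (by linarith)]
    linarith [ht.1]
  convert! (hasSum_poch_mul_pow m hx).mul_left ((l - 1) ^ (-m)) using 1
  · ext n
    rw [div_pow, div_pow, one_pow]
    ring
  · have : 1 - (1 - t) / (1 - l) = (l - t) / (l - 1) := by
      field_simp
      ring
    rw [this, ← Real.mul_rpow hl1.le (by positivity)]
    congr 1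
    field_simp

theorem integral_sub_rpow_mul_hyp2F1 {a b l : ℝ} (m : ℝ) (ha : 0 < a) (hb : 0 < b) (hl : 2 < l) :
    IntervalIntegrable (fun t => (l - t) ^ (-m) * t ^ (a + b - 1) * hyp2F1 a b (a + b) t)
      volume 0 1 ∧
    1 / (a * b) * (l - 1) ^ (-m) * hyp3F2 1 1 m (a + 1) (b + 1) (1 / (1 - l)) =
      betaR a b * ∫ t in (0 : ℝ)..1,
        (l - t) ^ (-m) * t ^ (a + b - 1) * hyp2F1 a b (a + b) t := by
  set g : ℝ → ℝ := fun t => t ^ (a + b - 1) * hyp2F1 a b (a + b) t with hg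
  set x : ℝ := 1 / (1 - l) with hx
  set d : ℕ → ℝ := fun n => (l - 1) ^ (-m) * (poch m n / n.factorial * x ^ n) with hd
  have hx1 : |x| < 1 := by
    rw [hx, abs_div, abs_one, abs_of_neg (by linarith), div_lt_one (by linarith)]
    linarith
  have hdsum : Summable fun n => |d n| := ((hasSum_poch_mul_pow m hx1).summable.mul_left _).abs
  have hgI : IntegrableOn g (Ioo 0 1) := by simpa [hg] using (moment_hyp2F1 ha hb 0).1
  have hcont : ContinuousOn (fun t : ℝ => (l - t) ^ (-m)) (uIcc 0 1) := by
    refine ContinuousOn.rpow_const (by fun_prop) fun t ht => Or.inl ?_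
    rw [uIcc_of_le zero_le_one] at ht
    linarith [ht.2]
  simp only [mul_assoc _ (_ ^ (a + b - 1) : ℝ) (hyp2F1 _ _ _ _)]
  refine ⟨((intervalIntegrable_iff_integrableOn_Ioo_of_le zero_le_one).2 hgI).continuousOn_mul
    hcont, ?_⟩
  have hmain : HasSum (fun n => ∫ t in Ioo (0 : ℝ) 1, d n * ((1 - t) ^ n * g t))
      (∫ t in Ioo (0 : ℝ) 1, (l - t) ^ (-m) * g t) := by
    refine hasSum_integral_of_dominated_convergence (fun n t => |d n| * |g t|)
      (fun n => ((moment_hyp2F1 ha hb n).1.const_mul (d n)).1) (fun n => ?_)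
      (ae_of_all _ fun t => hdsum.mul_right _) ?_ ?_
    · filter_upwards [ae_restrict_mem measurableSet_Ioo] with t ht
      have h1 : |1 - t| ≤ 1 := abs_le.2 ⟨by linarith [ht.2], by linarith [ht.1]⟩
      rw [Real.norm_eq_abs, abs_mul (d n), abs_mul _ (g t), abs_pow]
      gcongr
      exact mul_le_of_le_one_left (abs_nonneg _) (pow_le_one₀ (abs_nonneg _) h1)
    · simp only [tsum_mul_right]
      exact hgI.abs.const_mul _
    · filter_upwards [ae_restrict_mem measurableSet_Ioo] with t ht
      simpa only [mul_assoc, hd] using (hasSum_sub_rpow m hl ht).mul_right (g t)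
  rw [intervalIntegral.integral_of_le zero_le_one, integral_Ioc_eq_integral_Ioo,
    ← (hmain.mul_left (betaR a b)).tsum_eq, hyp3F2, ← tsum_mul_left]
  refine tsum_congr fun n => ?_
  have hpa := (poch_pos (add_pos ha one_pos) n).ne'
  have hpb := (poch_pos (add_pos hb one_pos) n).ne'
  rw [integral_const_mul, mul_left_comm (betaR a b), (moment_hyp2F1 ha hb n).2, poch_one, poch_succ_left,
    poch_succ_left]
  simp only [hd]
  field_simp

/-- for `α, β ∈ (0,1)`, `μ ∈ ℝ` and `λ > 2`, the integral
`∫₀¹ (λ−t)^{μ−1} t^{1−α−β} ₂F₁(1−α,1−β;2−α−β;t) dt` converges and equals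
`H_μ(λ)/B(1−α,1−β)`. -/
theorem stmt8 (α β μ l : ℝ) (hα : α ∈ Ioo (0 : ℝ) 1) (hβ : β ∈ Ioo (0 : ℝ) 1)
    (hl : 2 < l) :
    IntervalIntegrable
      (fun t => (l - t) ^ (μ - 1) * t ^ (1 - α - β) * hyp2F1 (1 - α) (1 - β) (2 - α - β) t)
      volume 0 1 ∧
    Hfun α β μ l = betaR (1 - α) (1 - β) *
      ∫ t in (0 : ℝ)..1,
        (l - t) ^ (μ - 1) * t ^ (1 - α - β) * hyp2F1 (1 - α) (1 - β) (2 - α - β) t := by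
  have ha : 0 < 1 - α := by linarith [hα.2]
  have hb : 0 < 1 - β := by linarith [hβ.2]
  have h := integral_sub_rpow_mul_hyp2F1 (1 - μ) ha hb hl
  rwa [show -(1 - μ) = μ - 1 by ring, show 1 - α + (1 - β) = 2 - α - β by ring,
    show 2 - α - β - 1 = 1 - α - β by ring, show 1 - α + 1 = 2 - α by ring,
    show 1 - β + 1 = 2 - β by ring] at h
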